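/- For every finite simple graph G, χ_lid(G\R) − t(G) ≤ χ_lid(G). Equivalently, χ_lid(G\R) ≤ χ_lid(G) + t(G): if G admits a lid-coloring with n colors, then its maximal twin-free induced subgraph G\R admits a lid-coloring with at most n + t(G) colors. -/

import Mathlib

open SimpleGraph

variable {V : Type*}

/-- The closed neighborhood `N[u]` of a vertex `u`. -/
def closedNbhd (G : SimpleGraph V) (u : V) : Set V := insert u (G.neighborSet u)

/-- Two vertices are twins if they have the same closed neighborhood. -/
def Twins (G : SimpleGraph V) (u v : V) : Prop := closedNbhd G u = closedNbhd G v

/-- `c` is a locally identifying (lid-) coloring of `G`: a proper coloring such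
that every pair of adjacent non-twin vertices gets distinct color sets on their
closed neighborhoods. -/
def IsLidColoring {α : Type*} (G : SimpleGraph V) (c : V → α) : Prop :=
  (∀ u v : V, G.Adj u v → c u ≠ c v) ∧
  ∀ u v : V, G.Adj u v → ¬ Twins G u v → c '' closedNbhd G u ≠ c '' closedNbhd G v

/-- `χ_lid(G)`: the minimum number of colors in a lid-coloring of `G`. -/
noncomputable def chiLid (G : SimpleGraph V) : ℕ :=
  sInf {n | ∃ c : V → Fin n, IsLidColoring G c}

/-- `s` is a set of representatives of the twin-equivalence classes of `G`:
it contains exactly one vertex from each class. The induced subgraph of `G` on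
such a set is the maximal twin-free induced subgraph `G\R` (the quotient of `G`
by the twin relation `R`), well-defined up to isomorphism. -/
def IsRepSet (G : SimpleGraph V) (s : Finset V) : Prop :=
  ∀ v : V, ∃! w, w ∈ s ∧ Twins G v w

open Classical in
/-- The twin-equivalence class of a vertex, as a `Finset`. -/
noncomputable def twinClass (G : SimpleGraph V) [Fintype V] (v : V) : Finset V :=
  Finset.univ.filter (Twins G v)

open Classical in
/-- `t(G)`: the number of twin-equivalence classes with at least two vertices. -/
noncomputable def numBigTwinClasses (G : SimpleGraph V) [Fintype V] : ℕ :=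
  ((Finset.univ.image (twinClass G)).filter (fun Q => 2 ≤ Q.card)).card

lemma mem_closedNbhd_comm {G : SimpleGraph V} {u v : V} :
    u ∈ closedNbhd G v ↔ v ∈ closedNbhd G u := by
  simp [closedNbhd, G.adj_comm, eq_comm]

lemma Twins.mem_closedNbhd_iff {G : SimpleGraph V} {u v : V} (h : Twins G u v) (x : V) :
    u ∈ closedNbhd G x ↔ v ∈ closedNbhd G x := by
  rw [mem_closedNbhd_comm, h, mem_closedNbhd_comm]

lemma mem_closedNbhd_induce {G : SimpleGraph V} {s : Set V} {u v : s} :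
    u ∈ closedNbhd (G.induce s) v ↔ (u : V) ∈ closedNbhd G v := by
  simp [closedNbhd, Subtype.ext_iff]

lemma Twins.induce {G : SimpleGraph V} {s : Set V} {u v : s} (h : Twins G (u : V) v) :
    Twins (G.induce s) u v := by
  ext x
  rw [mem_closedNbhd_induce, mem_closedNbhd_induce, h]

lemma twinClass_eq_iff [Fintype V] {G : SimpleGraph V} {u v : V} :
    twinClass G u = twinClass G v ↔ Twins G u v := by
  constructor
  · intro h
    have hv : v ∈ twinClass G v := by simp [twinClass, Twins]
    rw [← h] at hv
    simpa [twinClass] using hv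
  · intro h
    ext x
    simp only [twinClass, Finset.mem_filter, Finset.mem_univ, true_and, Twins]
    rw [h]

lemma Twins.eq_of_card_twinClass_lt_two [Fintype V] {G : SimpleGraph V} {u v : V}
    (h : Twins G u v) (hu : ¬ 2 ≤ (twinClass G u).card) : u = v :=
  Finset.card_le_one.mp (Nat.lt_succ_iff.mp (not_le.mp hu)) u (by simp [twinClass, Twins]) v
    (by simpa [twinClass] using h)

/-- An injective relabelling of the colors preserves lid-colorings. -/
lemma IsLidColoring.comp {α β : Type*} {G : SimpleGraph V} {c : V → α}
    (hc : IsLidColoring G c) {f : α → β} (hf : Function.Injective f) :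
    IsLidColoring G (f ∘ c) := by
  refine ⟨fun u v huv h => hc.1 u v huv (hf h), fun u v huv hne h => hc.2 u v huv hne ?_⟩
  rw [Set.image_comp, Set.image_comp] at h
  exact hf.image_injective h

lemma IsLidColoring.chiLid_le_card {α : Type*} [Fintype α] {G : SimpleGraph V} {c : V → α}
    (hc : IsLidColoring G c) : chiLid G ≤ Fintype.card α :=
  Nat.sInf_le ⟨_, hc.comp (Fintype.equivFin α).injective⟩

lemma isLidColoring_id (G : SimpleGraph V) : IsLidColoring G (id : V → V) :=
  ⟨fun _ _ huv => huv.ne, fun _ _ _ hne h => hne (by simpa [Twins] using h)⟩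

lemma exists_isLidColoring_chiLid [Fintype V] (G : SimpleGraph V) :
    ∃ c : V → Fin (chiLid G), IsLidColoring G c :=
  Nat.sInf_mem (s := {n | ∃ c : V → Fin n, IsLidColoring G c})
    ⟨_, _, (isLidColoring_id G).comp (Fintype.equivFin V).injective⟩

open Classical in
/-- Recolor every vertex lying in a twin class with at least two elements by its twin class,
keeping the color of the other vertices. -/
noncomputable def twinRecolor [Fintype V] {α : Type*} (G : SimpleGraph V) (c : V → α) (v : V) :
    α ⊕ {Q // Q ∈ (Finset.univ.image (twinClass G)).filter (fun Q => 2 ≤ Q.card)} :=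
  if h : 2 ≤ (twinClass G v).card then
    Sum.inr ⟨twinClass G v, by simp [h]⟩
  else Sum.inl (c v)

lemma twinRecolor_eq [Fintype V] {α : Type*} {G : SimpleGraph V} {c : V → α} {u v : V}
    (h : twinRecolor G c u = twinRecolor G c v) :
    Twins G u v ∨ (¬ 2 ≤ (twinClass G u).card ∧ c u = c v) := by
  unfold twinRecolor at h
  split_ifs at h with hu hv
  · exact Or.inl (twinClass_eq_iff.mp (by simpa using h))
  · exact Or.inr ⟨hu, by simpa using h⟩

/-- On a set of representatives, `twinRecolor G c` distinguishes closed neighborhoods at least as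
well as `c` does on `G`. -/
lemma image_closedNbhd_subset_of_twinRecolor [Fintype V] {α : Type*} {G : SimpleGraph V}
    {s : Finset V} (hs : IsRepSet G s) {c : V → α} {u v : (s : Set V)}
    (h : (fun x : (s : Set V) => twinRecolor G c x) '' closedNbhd (G.induce (s : Set V)) u ⊆
      (fun x : (s : Set V) => twinRecolor G c x) '' closedNbhd (G.induce (s : Set V)) v) :
    c '' closedNbhd G u ⊆ c '' closedNbhd G v := by
  rintro _ ⟨w, hw, rfl⟩
  obtain ⟨r, ⟨hrs, hwr⟩, -⟩ := hs w
  obtain ⟨x, hx, hxr⟩ := h ⟨⟨r, hrs⟩, mem_closedNbhd_induce.mpr ((hwr.mem_closedNbhd_iff _).mp hw),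
    rfl⟩
  rw [mem_closedNbhd_induce] at hx
  rcases twinRecolor_eq hxr.symm with hrx | ⟨hr, hcr⟩
  · exact ⟨w, (hwr.mem_closedNbhd_iff _).mpr ((hrx.mem_closedNbhd_iff _).mpr hx), rfl⟩
  · have hrw : r = w := Twins.eq_of_card_twinClass_lt_two hwr.symm hr
    exact ⟨x, hx, by rw [← hcr, ← hrw]⟩

lemma IsLidColoring.twinRecolor_induce [Fintype V] {α : Type*} {G : SimpleGraph V}
    {s : Finset V} (hs : IsRepSet G s) {c : V → α} (hc : IsLidColoring G c) :
    IsLidColoring (G.induce (s : Set V)) (fun x => twinRecolor G c x) := by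
  refine ⟨fun u v huv h => ?_, fun u v huv hne h => ?_⟩
  · rcases twinRecolor_eq h with ht | ⟨-, hcuv⟩
    · exact huv.ne (Subtype.ext ((hs u).unique ⟨u.2, rfl⟩ ⟨v.2, ht⟩))
    · exact hc.1 _ _ huv hcuv
  · exact hc.2 u v huv (fun ht => hne ht.induce)
      ((image_closedNbhd_subset_of_twinRecolor hs h.subset).antisymm
        (image_closedNbhd_subset_of_twinRecolor hs h.superset))

/-- For every finite simple graph `G`, `χ_lid(G\R) ≤ χ_lid(G) + t(G)`,
i.e. `χ_lid(G\R) - t(G) ≤ χ_lid(G)`. -/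
theorem chiLid_quotient_le_chiLid_add [Fintype V] (G : SimpleGraph V)
    (s : Finset V) (hs : IsRepSet G s) :
    chiLid (G.induce (↑s : Set V)) ≤ chiLid G + numBigTwinClasses G := by
  obtain ⟨c, hc⟩ := exists_isLidColoring_chiLid G
  refine (hc.twinRecolor_induce hs).chiLid_le_card.trans_eq ?_
  rw [Fintype.card_sum, Fintype.card_fin, Fintype.card_coe, numBigTwinClasses]
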